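/- arXiv:2410.04136 — 2 statements merged into one kernel-verified Lean document; each statement's English description precedes it below -/
import Mathlib

section
/- Let c = (c_n)_{n≥1} be a P-admissible sequence with x_0 = val_P(c), and assume x_0 = Sup^P(b_1…b_m) for some P-admissible finite tuple (b_1,…,b_m). For each n ≥ 1 let d^{(n)} be a P-admissible sequence with d^{(n)} ≠ c, set x_n = val_P(d^{(n)}), and assume 0 < x_n < x_0 for all n. Let k_n = min{ j ≥ 1 : d^{(n)}_j ≠ c_j }. Then x_n → x_0 if and only if k_n → ∞. -/
open Filter Finset Topology

/-! `φ` encodes the family of functions: `φ []` is `φ₀` and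
`φ [c₁, …, cₙ]` is `φₙ(c₁, …, cₙ)`. Sequences are 0-indexed:
`p 0` is the paper's `p₁`. -/

/-- The list of the first `n` terms of the sequence `p`. -/
def prefixList (p : ℕ → ℕ) (n : ℕ) : List ℕ :=
  List.ofFn (fun i : Fin n => p i)

/-- A sequence `p` is `P`-admissible if `pₙ ≥ r_{n-1} + 1` for all `n ≥ 1`. -/
def PAdmissibleSeq (φ : List ℕ → ℕ) (p : ℕ → ℕ) : Prop :=
  ∀ n : ℕ, φ (prefixList p n) + 1 ≤ p n

/-- A tuple `(c₁, …, c_k)` (given as the first `k` values of `c`) is `P`-admissible. -/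
def PAdmissibleTuple (φ : List ℕ → ℕ) (c : ℕ → ℕ) (k : ℕ) : Prop :=
  ∀ n < k, φ (prefixList c n) + 1 ≤ c n

/-- `r₀ r₁ ⋯ rₙ` where `rᵢ = φᵢ(p₁, …, pᵢ)`. -/
noncomputable def numer (φ : List ℕ → ℕ) (p : ℕ → ℕ) (n : ℕ) : ℝ :=
  ∏ i ∈ Finset.range (n + 1), (φ (prefixList p i) : ℝ)

/-- `(p₁ − 1)p₁ ⋯ (pₙ − 1)pₙ`. -/
noncomputable def denomBase (p : ℕ → ℕ) (n : ℕ) : ℝ :=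
  ∏ j ∈ Finset.range n, (((p j : ℝ) - 1) * (p j : ℝ))

/-- The `P`-value `val_P(p) = Σ_{n=0}^∞ (r₀⋯rₙ)/((p₁−1)p₁⋯(pₙ−1)pₙ·p_{n+1})`. -/
noncomputable def valP (φ : List ℕ → ℕ) (p : ℕ → ℕ) : ℝ :=
  ∑' n : ℕ, numer φ p n / (denomBase p n * (p n : ℝ))

/-- The `P⁻`-value
`val_{P⁻}(q) = Σ_{n=0}^∞ (−1)ⁿ (r₀⋯rₙ)/((q₁−1)q₁⋯(qₙ−1)qₙ·(q_{n+1}−1))`. -/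
noncomputable def valPNeg (φ : List ℕ → ℕ) (q : ℕ → ℕ) : ℝ :=
  ∑' n : ℕ, (-1 : ℝ) ^ n * numer φ q n / (denomBase q n * ((q n : ℝ) - 1))

/-- `Inf^P(c₁…c_k) = Σ_{n=0}^{k−1} (r₀⋯rₙ)/((c₁−1)c₁⋯(cₙ−1)cₙ·c_{n+1})`. -/
noncomputable def InfP (φ : List ℕ → ℕ) (c : ℕ → ℕ) (k : ℕ) : ℝ :=
  ∑ n ∈ Finset.range k, numer φ c n / (denomBase c n * (c n : ℝ))

/-- The diameter `(r₀⋯r_{k−1})/((c₁−1)c₁⋯(c_k−1)c_k)`. -/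
noncomputable def DiamP (φ : List ℕ → ℕ) (c : ℕ → ℕ) (k : ℕ) : ℝ :=
  (∏ i ∈ Finset.range k, (φ (prefixList c i) : ℝ)) / denomBase c k

/-- `Sup^P(c₁…c_k) = Inf^P(c₁…c_k) + (r₀⋯r_{k−1})/((c₁−1)c₁⋯(c_k−1)c_k)`. -/
noncomputable def SupP (φ : List ℕ → ℕ) (c : ℕ → ℕ) (k : ℕ) : ℝ :=
  InfP φ c k + DiamP φ c k

/-- `A(c₁…c_k) = Σ_{n=0}^{k−1} (−1)ⁿ (r₀⋯rₙ)/((c₁−1)c₁⋯(cₙ−1)cₙ·(c_{n+1}−1))`. -/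
noncomputable def APNeg (φ : List ℕ → ℕ) (c : ℕ → ℕ) (k : ℕ) : ℝ :=
  ∑ n ∈ Finset.range k, (-1 : ℝ) ^ n * numer φ c n / (denomBase c n * ((c n : ℝ) - 1))

/-- `Sup^{P⁻}(c₁…c_k)`: `A` if `k` odd, `A + D` if `k` even. -/
noncomputable def SupPNeg (φ : List ℕ → ℕ) (c : ℕ → ℕ) (k : ℕ) : ℝ :=
  if Odd k then APNeg φ c k else APNeg φ c k + DiamP φ c k

/-- `Inf^{P⁻}(c₁…c_k)`: `A − D` if `k` odd, `A` if `k` even. -/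
noncomputable def InfPNeg (φ : List ℕ → ℕ) (c : ℕ → ℕ) (k : ℕ) : ℝ :=
  if Odd k then APNeg φ c k - DiamP φ c k else APNeg φ c k

section Aux

variable {φ : List ℕ → ℕ} {p q : ℕ → ℕ} {n : ℕ}

theorem prefixList_congr (h : ∀ j < n, p j = q j) : prefixList p n = prefixList q n := by
  unfold prefixList
  congr 1
  funext i
  exact h i i.isLt

theorem InfP_zero (φ : List ℕ → ℕ) (p : ℕ → ℕ) : InfP φ p 0 = 0 := by simp [InfP]

theorem DiamP_zero (φ : List ℕ → ℕ) (p : ℕ → ℕ) : DiamP φ p 0 = 1 := by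
  simp [DiamP, denomBase]

theorem DiamP_succ (φ : List ℕ → ℕ) (p : ℕ → ℕ) (n : ℕ) :
    DiamP φ p (n + 1) =
      DiamP φ p n * ((φ (prefixList p n) : ℝ) / (((p n : ℝ) - 1) * (p n : ℝ))) := by
  simp only [DiamP, denomBase, Finset.prod_range_succ]
  rw [mul_div_mul_comm]

theorem InfP_succ (φ : List ℕ → ℕ) (p : ℕ → ℕ) (n : ℕ) :
    InfP φ p (n + 1) = InfP φ p n + DiamP φ p n * ((φ (prefixList p n) : ℝ) / (p n : ℝ)) := by
  simp only [InfP, DiamP, numer, Finset.sum_range_succ, Finset.prod_range_succ]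
  rw [mul_div_mul_comm]

theorem DiamP_congr (h : ∀ j < n, p j = q j) : DiamP φ p n = DiamP φ q n := by
  induction n with
  | zero => simp [DiamP_zero]
  | succ n ih =>
    have h' : ∀ j < n, p j = q j := fun j hj => h j (by omega)
    rw [DiamP_succ, DiamP_succ, ih h', prefixList_congr h', h n (by omega)]

theorem InfP_congr (h : ∀ j < n, p j = q j) : InfP φ p n = InfP φ q n := by
  induction n with
  | zero => simp [InfP_zero]
  | succ n ih =>
    have h' : ∀ j < n, p j = q j := fun j hj => h j (by omega)
    rw [InfP_succ, InfP_succ, ih h', DiamP_congr h', prefixList_congr h', h n (by omega)]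

theorem one_lt_of_admissible (hφ : ∀ l, 0 < φ l) (hp : PAdmissibleSeq φ p) (n : ℕ) :
    (1 : ℝ) < p n := by
  have h1 := hp n
  have h2 := hφ (prefixList p n)
  exact_mod_cast (by omega : 1 < p n)

theorem cast_le_sub_one_of_admissible (hp : PAdmissibleSeq φ p) (n : ℕ) :
    (φ (prefixList p n) : ℝ) ≤ (p n : ℝ) - 1 := by
  have h : ((φ (prefixList p n) + 1 : ℕ) : ℝ) ≤ p n := by exact_mod_cast hp n
  push_cast at h
  linarith

theorem DiamP_pos (hφ : ∀ l, 0 < φ l) (hp : PAdmissibleSeq φ p) (n : ℕ) : 0 < DiamP φ p n := by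
  induction n with
  | zero => simp [DiamP_zero]
  | succ n ih =>
    have h1 := one_lt_of_admissible hφ hp n
    have h2 : (0 : ℝ) < φ (prefixList p n) := by exact_mod_cast hφ _
    rw [DiamP_succ]
    exact mul_pos ih (div_pos h2 (mul_pos (by linarith) (by linarith)))

theorem DiamP_le_half_pow (hφ : ∀ l, 0 < φ l) (hp : PAdmissibleSeq φ p) (n : ℕ) :
    DiamP φ p n ≤ (1 / 2 : ℝ) ^ n := by
  induction n with
  | zero => simp [DiamP_zero]
  | succ n ih =>
    have h1 := one_lt_of_admissible hφ hp n
    have h2 := cast_le_sub_one_of_admissible hp n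
    have h3 : (2 : ℝ) ≤ p n := by
      have : 1 < p n := by exact_mod_cast h1
      exact_mod_cast this
    rw [DiamP_succ, pow_succ]
    refine mul_le_mul ih ?_ (by positivity) (by positivity)
    rw [div_le_div_iff₀ (mul_pos (by linarith) (by linarith)) two_pos]
    nlinarith

theorem InfP_strictMono (hφ : ∀ l, 0 < φ l) (hp : PAdmissibleSeq φ p) :
    StrictMono (InfP φ p) := by
  refine strictMono_nat_of_lt_succ fun n => ?_
  have h1 := one_lt_of_admissible hφ hp n
  have h2 : (0 : ℝ) < φ (prefixList p n) := by exact_mod_cast hφ _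
  rw [InfP_succ]
  exact lt_add_of_pos_right _ (mul_pos (DiamP_pos hφ hp n) (div_pos h2 (by linarith)))

theorem SupP_succ (hφ : ∀ l, 0 < φ l) (hp : PAdmissibleSeq φ p) (n : ℕ) :
    SupP φ p (n + 1) =
      InfP φ p n + DiamP φ p n * ((φ (prefixList p n) : ℝ) / ((p n : ℝ) - 1)) := by
  have h1 := one_lt_of_admissible hφ hp n
  have h2 : (p n : ℝ) - 1 ≠ 0 := by linarith
  have h3 : (p n : ℝ) ≠ 0 := by linarith
  rw [SupP, InfP_succ, DiamP_succ]
  field_simp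
  ring

theorem SupP_antitone (hφ : ∀ l, 0 < φ l) (hp : PAdmissibleSeq φ p) :
    Antitone (SupP φ p) := by
  refine antitone_nat_of_succ_le fun n => ?_
  have h1 := one_lt_of_admissible hφ hp n
  rw [SupP_succ hφ hp, SupP]
  refine add_le_add_right (mul_le_of_le_one_right (DiamP_pos hφ hp n).le ?_) _
  rw [div_le_one (by linarith)]
  exact cast_le_sub_one_of_admissible hp n

theorem InfP_le_SupP (hφ : ∀ l, 0 < φ l) (hp : PAdmissibleSeq φ p) (m n : ℕ) :
    InfP φ p m ≤ SupP φ p n :=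
  calc InfP φ p m ≤ InfP φ p (max m n) := (InfP_strictMono hφ hp).monotone (le_max_left _ _)
    _ ≤ SupP φ p (max m n) := le_add_of_nonneg_right (DiamP_pos hφ hp _).le
    _ ≤ SupP φ p n := SupP_antitone hφ hp (le_max_right _ _)

theorem tendsto_InfP_valP (hφ : ∀ l, 0 < φ l) (hp : PAdmissibleSeq φ p) :
    Tendsto (InfP φ p) atTop (𝓝 (valP φ p)) := by
  refine (summable_of_sum_range_le (c := SupP φ p 0) (fun n => ?_)
    fun n => InfP_le_SupP hφ hp n 0).hasSum.tendsto_sum_nat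
  have h := (InfP_strictMono hφ hp).monotone n.le_succ
  simpa [InfP, Finset.sum_range_succ] using h

theorem InfP_lt_valP (hφ : ∀ l, 0 < φ l) (hp : PAdmissibleSeq φ p) (n : ℕ) :
    InfP φ p n < valP φ p :=
  ((InfP_strictMono hφ hp) n.lt_succ_self).trans_le
    ((InfP_strictMono hφ hp).monotone.ge_of_tendsto (tendsto_InfP_valP hφ hp) _)

theorem valP_le_SupP (hφ : ∀ l, 0 < φ l) (hp : PAdmissibleSeq φ p) (n : ℕ) :
    valP φ p ≤ SupP φ p n :=
  le_of_tendsto' (tendsto_InfP_valP hφ hp) fun m => InfP_le_SupP hφ hp m n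

/-- Of two sequences that first differ at position `n`, the one with the larger term there has
value at most the lower end of the cylinder of the other. -/
theorem valP_le_InfP_of_lt (hφ : ∀ l, 0 < φ l) (hp : PAdmissibleSeq φ p)
    (hq : PAdmissibleSeq φ q) (h : ∀ j < n, p j = q j) (hlt : q n < p n) :
    valP φ p ≤ InfP φ q (n + 1) := by
  refine (valP_le_SupP hφ hp (n + 1)).trans ?_
  rw [SupP_succ hφ hp, InfP_succ, InfP_congr h, DiamP_congr h, prefixList_congr h]
  have h1 := one_lt_of_admissible hφ hq n
  have h2 : (q n : ℝ) + 1 ≤ p n := by exact_mod_cast hlt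
  have h3 := (DiamP_pos hφ hq n).le
  gcongr
  linarith

theorem abs_valP_sub_le (hφ : ∀ l, 0 < φ l) (hp : PAdmissibleSeq φ p)
    (hq : PAdmissibleSeq φ q) (h : ∀ j < n, p j = q j) :
    |valP φ p - valP φ q| ≤ (1 / 2 : ℝ) ^ n := by
  have h1 := InfP_lt_valP hφ hp n
  have h2 := valP_le_SupP hφ hp n
  have h3 := InfP_lt_valP hφ hq n
  have h4 := valP_le_SupP hφ hq n
  have h5 := DiamP_le_half_pow hφ hq n
  rw [SupP, InfP_congr h, DiamP_congr h] at h2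
  rw [InfP_congr h] at h1
  rw [SupP] at h4
  rw [abs_le]
  constructor <;> linarith

end Aux

/-- if `x₀ = val_P(c)` is the supremum of some `P`-cylinder and the
sequence converges from the left, then `xₙ → x₀` iff `kₙ → ∞`. -/
theorem stmt2 (φ : List ℕ → ℕ) (hφ : ∀ l, 0 < φ l)
    (c : ℕ → ℕ) (hc : PAdmissibleSeq φ c)
    (hsup : ∃ m : ℕ, 0 < m ∧ ∃ b : ℕ → ℕ, PAdmissibleTuple φ b m ∧
      valP φ c = SupP φ b m)
    (d : ℕ → (ℕ → ℕ)) (hd : ∀ n, PAdmissibleSeq φ (d n))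
    (hdc : ∀ n, d n ≠ c)
    (hx : ∀ n, 0 < valP φ (d n) ∧ valP φ (d n) < valP φ c)
    (k : ℕ → ℕ)
    (hk : ∀ n, d n (k n) ≠ c (k n) ∧ ∀ j < k n, d n j = c j) :
    Filter.Tendsto (fun n => valP φ (d n)) Filter.atTop (nhds (valP φ c)) ↔
      Filter.Tendsto k Filter.atTop Filter.atTop := by
  constructor
  · intro hlim
    refine tendsto_atTop.2 fun K => ?_
    filter_upwards [hlim.eventually_const_lt (InfP_lt_valP hφ hc K)] with n hn
    obtain ⟨hne, heq⟩ := hk n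
    have hlt : c (k n) < d n (k n) := by
      by_contra! hle
      have h1 := valP_le_InfP_of_lt hφ hc (hd n) (fun j hj => (heq j hj).symm)
        (lt_of_le_of_ne hle hne)
      exact ((hx n).2.trans_le h1).not_gt (InfP_lt_valP hφ (hd n) _)
    have h1 := hn.trans_le (valP_le_InfP_of_lt hφ (hd n) hc heq hlt)
    exact Nat.lt_succ_iff.1 ((InfP_strictMono hφ hc).lt_iff_lt.1 h1)
  · intro hlim
    rw [tendsto_iff_norm_sub_tendsto_zero]
    refine squeeze_zero (fun n => norm_nonneg _)
      (fun n => abs_valP_sub_le hφ (hd n) hc (hk n).2) ?_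
    exact (tendsto_pow_atTop_nhds_zero_of_lt_one (by norm_num) (by norm_num)).comp hlim
end

section
/- Let k be odd, let (c_1,…,c_k) be a P-admissible finite tuple, and set x_0 = Sup^{P⁻}(c_1…c_k). For each n ≥ 1 let d^{(n)} be a P-admissible sequence with x_n = val_{P⁻}(d^{(n)}) satisfying 0 < x_n < x_0. Then x_n → x_0 if and only if there exists n_0 such that: (i) for all n ≥ n_0 and all i ≤ k one has d^{(n)}_i = c_i, and (ii) d^{(n)}_{k+1} → ∞ as n → ∞. -/
open Filter Finset Topology

/-- The family of functions governing the tail of a sequence whose first term is `a`. -/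
def shiftFamily (φ : List ℕ → ℕ) (a : ℕ) : List ℕ → ℕ := fun l => φ (a :: l)

lemma shiftFamily_pos {φ : List ℕ → ℕ} (hφ : ∀ l, 0 < φ l) (a : ℕ) (l : List ℕ) :
    0 < shiftFamily φ a l :=
  hφ (a :: l)

/-- The sequence `q` with its first term removed. -/
def seqTail (q : ℕ → ℕ) : ℕ → ℕ := fun n => q (n + 1)

lemma prefixList_succ (q : ℕ → ℕ) (n : ℕ) :
    prefixList q (n + 1) = q 0 :: prefixList (seqTail q) n := by
  simp [prefixList, seqTail, List.ofFn_succ]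

lemma numer_succ (φ : List ℕ → ℕ) (q : ℕ → ℕ) (n : ℕ) :
    numer φ q (n + 1) = φ [] * numer (shiftFamily φ (q 0)) (seqTail q) n := by
  unfold numer
  rw [prod_range_succ', mul_comm]
  simp only [prefixList_succ]
  rfl

lemma denomBase_succ (q : ℕ → ℕ) (n : ℕ) :
    denomBase q (n + 1) = ((q 0 : ℝ) - 1) * q 0 * denomBase (seqTail q) n := by
  unfold denomBase
  rw [prod_range_succ', mul_comm]
  rfl

/-- The `n`-th term of the series defining the `P⁻`-value. -/
noncomputable def termPNeg (φ : List ℕ → ℕ) (q : ℕ → ℕ) (n : ℕ) : ℝ :=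
  (-1 : ℝ) ^ n * numer φ q n / (denomBase q n * ((q n : ℝ) - 1))

lemma termPNeg_zero (φ : List ℕ → ℕ) (q : ℕ → ℕ) :
    termPNeg φ q 0 = φ [] / ((q 0 : ℝ) - 1) := by
  simp [termPNeg, numer, denomBase, prefixList]

lemma termPNeg_succ (φ : List ℕ → ℕ) (q : ℕ → ℕ) (n : ℕ) :
    termPNeg φ q (n + 1) =
      -(φ [] / (((q 0 : ℝ) - 1) * q 0)) * termPNeg (shiftFamily φ (q 0)) (seqTail q) n := by
  simp only [termPNeg, numer_succ, denomBase_succ, pow_succ, seqTail, div_eq_mul_inv, mul_inv]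
  ring

lemma APNeg_succ (φ : List ℕ → ℕ) (q : ℕ → ℕ) (k : ℕ) :
    APNeg φ q (k + 1) = φ [] / ((q 0 : ℝ) - 1) -
      φ [] / (((q 0 : ℝ) - 1) * q 0) * APNeg (shiftFamily φ (q 0)) (seqTail q) k := by
  change ∑ n ∈ range (k + 1), termPNeg φ q n =
    _ - _ * ∑ n ∈ range k, termPNeg (shiftFamily φ (q 0)) (seqTail q) n
  simp only [sum_range_succ', termPNeg_zero, termPNeg_succ, ← mul_sum]
  ring

lemma PAdmissibleTuple.first {φ : List ℕ → ℕ} {c : ℕ → ℕ} {k : ℕ}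
    (hc : PAdmissibleTuple φ c (k + 1)) : φ [] + 1 ≤ c 0 := by
  simpa [prefixList] using hc 0 k.succ_pos

lemma PAdmissibleTuple.tail {φ : List ℕ → ℕ} {c : ℕ → ℕ} {k : ℕ}
    (hc : PAdmissibleTuple φ c (k + 1)) :
    PAdmissibleTuple (shiftFamily φ (c 0)) (seqTail c) k := fun n hn => by
  have h := hc (n + 1) (Nat.succ_lt_succ hn)
  rwa [prefixList_succ] at h

lemma PAdmissibleSeq.tuple {φ : List ℕ → ℕ} {q : ℕ → ℕ} (hq : PAdmissibleSeq φ q) (k : ℕ) :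
    PAdmissibleTuple φ q k := fun n _ => hq n

lemma PAdmissibleSeq.first {φ : List ℕ → ℕ} {q : ℕ → ℕ} (hq : PAdmissibleSeq φ q) :
    φ [] + 1 ≤ q 0 :=
  (hq.tuple 1).first

lemma PAdmissibleSeq.tail {φ : List ℕ → ℕ} {q : ℕ → ℕ} (hq : PAdmissibleSeq φ q) :
    PAdmissibleSeq (shiftFamily φ (q 0)) (seqTail q) := fun n =>
  (hq.tuple (n + 2)).tail n n.lt_succ_self

section Digit

variable {r a : ℕ}

lemma digit_sub_one_pos (hr : 0 < r) (ha : r + 1 ≤ a) : (0 : ℝ) < (a : ℝ) - 1 := by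
  have : ((r + 1 : ℕ) : ℝ) ≤ a := by exact_mod_cast ha
  have : (0 : ℝ) < r := by exact_mod_cast hr
  push_cast at *
  linarith

lemma digit_coeff_pos (hr : 0 < r) (ha : r + 1 ≤ a) :
    (0 : ℝ) < r / (((a : ℝ) - 1) * a) := by
  have h1 := digit_sub_one_pos hr ha
  have : (0 : ℝ) < a := by linarith
  positivity

lemma digit_lead_le_one (hr : 0 < r) (ha : r + 1 ≤ a) : (r : ℝ) / ((a : ℝ) - 1) ≤ 1 := by
  rw [div_le_one (digit_sub_one_pos hr ha), le_sub_iff_add_le]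
  exact_mod_cast ha

lemma digit_lead_sub_coeff (hr : 0 < r) (ha : r + 1 ≤ a) :
    (r : ℝ) / ((a : ℝ) - 1) - r / (((a : ℝ) - 1) * a) = r / a := by
  have h1 := digit_sub_one_pos hr ha
  have : (0 : ℝ) < a := by linarith
  field_simp

lemma digit_coeff_le_half (hr : 0 < r) (ha : r + 1 ≤ a) :
    (r : ℝ) / (((a : ℝ) - 1) * a) ≤ 1 / 2 := by
  have h1 := digit_sub_one_pos hr ha
  have h2 : (2 : ℝ) ≤ a := by exact_mod_cast (by omega : 2 ≤ a)
  rw [← div_div]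
  exact div_le_div₀ zero_le_one (digit_lead_le_one hr ha) two_pos h2

lemma div_digit_pos (hr : 0 < r) (ha : r + 1 ≤ a) : (0 : ℝ) < r / a := by
  have : 0 < a := by omega
  positivity

end Digit

lemma APNeg_mem_Icc {φ : List ℕ → ℕ} (hφ : ∀ l, 0 < φ l) {c : ℕ → ℕ} {k : ℕ}
    (hc : PAdmissibleTuple φ c k) : APNeg φ c k ∈ Set.Icc (0 : ℝ) 1 := by
  induction k generalizing φ c with
  | zero => simp [APNeg]
  | succ k ih =>
    obtain ⟨h0, h1⟩ := ih (shiftFamily_pos hφ (c 0)) hc.tail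
    have hD := digit_coeff_pos (hφ []) hc.first
    have hle := digit_lead_le_one (hφ []) hc.first
    have hsub := digit_lead_sub_coeff (hφ []) hc.first
    have hpos := div_digit_pos (hφ []) hc.first
    rw [APNeg_succ]
    constructor <;> nlinarith

lemma APNeg_pos_of_odd {φ : List ℕ → ℕ} (hφ : ∀ l, 0 < φ l) {c : ℕ → ℕ} {k : ℕ}
    (hc : PAdmissibleTuple φ c k) (hk : Odd k) : 0 < APNeg φ c k := by
  cases k with
  | zero => simp at hk
  | succ k =>
    have h1 := (APNeg_mem_Icc (shiftFamily_pos hφ (c 0)) hc.tail).2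
    have hD := digit_coeff_pos (hφ []) hc.first
    have hsub := digit_lead_sub_coeff (hφ []) hc.first
    have hpos := div_digit_pos (hφ []) hc.first
    rw [APNeg_succ]
    have := mul_le_of_le_one_right hD.le h1
    linarith

lemma APNeg_lt_one_of_even {φ : List ℕ → ℕ} (hφ : ∀ l, 0 < φ l) {c : ℕ → ℕ} {k : ℕ}
    (hc : PAdmissibleTuple φ c k) (hk : Even k) : APNeg φ c k < 1 := by
  cases k with
  | zero => simp [APNeg]
  | succ k =>
    have h0 := APNeg_pos_of_odd (shiftFamily_pos hφ (c 0)) hc.tail (by grind)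
    have hD := digit_coeff_pos (hφ []) hc.first
    have hle := digit_lead_le_one (hφ []) hc.first
    rw [APNeg_succ]
    have := mul_pos hD h0
    linarith

lemma abs_termPNeg_le {φ : List ℕ → ℕ} (hφ : ∀ l, 0 < φ l) {q : ℕ → ℕ}
    (hq : PAdmissibleSeq φ q) (n : ℕ) : |termPNeg φ q n| ≤ (1 / 2) ^ n := by
  induction n generalizing φ q with
  | zero =>
    rw [termPNeg_zero, pow_zero,
      abs_of_nonneg (div_nonneg (Nat.cast_nonneg _) (digit_sub_one_pos (hφ []) hq.first).le)]
    exact digit_lead_le_one (hφ []) hq.first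
  | succ n ih =>
    rw [termPNeg_succ, abs_mul, abs_neg, abs_of_pos (digit_coeff_pos (hφ []) hq.first), pow_succ']
    exact mul_le_mul (digit_coeff_le_half (hφ []) hq.first)
      (ih (shiftFamily_pos hφ (q 0)) hq.tail) (abs_nonneg _) (by norm_num)

lemma summable_termPNeg {φ : List ℕ → ℕ} (hφ : ∀ l, 0 < φ l) {q : ℕ → ℕ}
    (hq : PAdmissibleSeq φ q) : Summable (termPNeg φ q) :=
  Summable.of_norm_bounded (summable_geometric_of_lt_one (by norm_num) (by norm_num))
    (abs_termPNeg_le hφ hq)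

lemma valPNeg_eq_sub {φ : List ℕ → ℕ} (hφ : ∀ l, 0 < φ l) {q : ℕ → ℕ}
    (hq : PAdmissibleSeq φ q) :
    valPNeg φ q = φ [] / ((q 0 : ℝ) - 1) -
      φ [] / (((q 0 : ℝ) - 1) * q 0) * valPNeg (shiftFamily φ (q 0)) (seqTail q) := by
  change ∑' n, termPNeg φ q n =
    _ - _ * ∑' n, termPNeg (shiftFamily φ (q 0)) (seqTail q) n
  rw [(summable_termPNeg hφ hq).tsum_eq_zero_add]
  simp only [termPNeg_zero, termPNeg_succ, tsum_mul_left]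
  ring

lemma valPNeg_mem_Icc {φ : List ℕ → ℕ} (hφ : ∀ l, 0 < φ l) {q : ℕ → ℕ}
    (hq : PAdmissibleSeq φ q) : valPNeg φ q ∈ Set.Icc (0 : ℝ) 1 :=
  isClosed_Icc.mem_of_tendsto (summable_termPNeg hφ hq).hasSum.tendsto_sum_nat
    (Eventually.of_forall fun k => APNeg_mem_Icc hφ (hq.tuple k))

lemma valPNeg_pos {φ : List ℕ → ℕ} (hφ : ∀ l, 0 < φ l) {q : ℕ → ℕ}
    (hq : PAdmissibleSeq φ q) : 0 < valPNeg φ q := by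
  have h1 := (valPNeg_mem_Icc (shiftFamily_pos hφ (q 0)) hq.tail).2
  have hsub := digit_lead_sub_coeff (hφ []) hq.first
  have hpos := div_digit_pos (hφ []) hq.first
  have := mul_le_of_le_one_right (digit_coeff_pos (hφ []) hq.first).le h1
  rw [valPNeg_eq_sub hφ hq]
  linarith

lemma valPNeg_lt_lead {φ : List ℕ → ℕ} (hφ : ∀ l, 0 < φ l) {q : ℕ → ℕ}
    (hq : PAdmissibleSeq φ q) : valPNeg φ q < φ [] / ((q 0 : ℝ) - 1) := by
  have := mul_pos (digit_coeff_pos (hφ []) hq.first)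
    (valPNeg_pos (shiftFamily_pos hφ (q 0)) hq.tail)
  rw [valPNeg_eq_sub hφ hq]
  linarith

lemma div_digit_lt_valPNeg {φ : List ℕ → ℕ} (hφ : ∀ l, 0 < φ l) {q : ℕ → ℕ}
    (hq : PAdmissibleSeq φ q) : φ [] / (q 0 : ℝ) < valPNeg φ q := by
  have hlt := (valPNeg_lt_lead (shiftFamily_pos hφ (q 0)) hq.tail).trans_le
    (digit_lead_le_one (shiftFamily_pos hφ (q 0) []) hq.tail.first)
  have := mul_lt_of_lt_one_right (digit_coeff_pos (hφ []) hq.first) hlt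
  have hsub := digit_lead_sub_coeff (hφ []) hq.first
  rw [valPNeg_eq_sub hφ hq]
  linarith

/-- The first term of an admissible sequence is determined by its `P⁻`-value. -/
lemma first_eq_of_valPNeg_mem_Ioo {φ : List ℕ → ℕ} (hφ : ∀ l, 0 < φ l) {q : ℕ → ℕ}
    (hq : PAdmissibleSeq φ q) {a : ℕ} (ha : φ [] + 1 ≤ a)
    (h : valPNeg φ q ∈ Set.Ioo (φ [] / (a : ℝ)) (φ [] / ((a : ℝ) - 1))) : q 0 = a := by
  have hr : (0 : ℝ) < φ [] := by exact_mod_cast hφ []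
  have ha1 := digit_sub_one_pos (hφ []) ha
  have hq1 := digit_sub_one_pos (hφ []) hq.first
  have h1 := h.1.trans (valPNeg_lt_lead hφ hq)
  have h2 := (div_digit_lt_valPNeg hφ hq).trans h.2
  rw [div_lt_div_iff_of_pos_left hr (by linarith) (by linarith)] at h1 h2
  have h1' : q 0 < a + 1 := by exact_mod_cast (by linarith : (q 0 : ℝ) < a + 1)
  have h2' : a < q 0 + 1 := by exact_mod_cast (by linarith : (a : ℝ) < q 0 + 1)
  omega

section Tendsto

variable {ι : Type*} {l : Filter ι}

lemma tendsto_valPNeg_zero_iff {φ : List ℕ → ℕ} (hφ : ∀ l, 0 < φ l) {d : ι → ℕ → ℕ}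
    (hd : ∀ᶠ n in l, PAdmissibleSeq φ (d n)) :
    Tendsto (fun n => valPNeg φ (d n)) l (𝓝 0) ↔ Tendsto (fun n => d n 0) l atTop := by
  have hr : (0 : ℝ) < φ [] := by exact_mod_cast hφ []
  rw [← tendsto_natCast_atTop_iff (R := ℝ)]
  constructor
  · intro h
    have hz : Tendsto (fun n => (φ [] : ℝ) / (d n 0 : ℝ)) l (𝓝[>] 0) := by
      refine tendsto_nhdsWithin_iff.2 ⟨squeeze_zero' (Eventually.of_forall fun n => by positivity)
        (hd.mono fun n hn => (div_digit_lt_valPNeg hφ hn).le) h,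
        hd.mono fun n hn => div_digit_pos (hφ []) hn.first⟩
    refine (hz.inv_tendsto_nhdsGT_zero.const_mul_atTop hr).congr fun n => ?_
    simp [mul_div_cancel₀ _ hr.ne']
  · intro h
    have hz : Tendsto (fun n => (φ [] : ℝ) / ((d n 0 : ℝ) - 1)) l (𝓝 0) :=
      (tendsto_atTop_add_const_right l (-1) h).const_div_atTop _
    exact squeeze_zero' (hd.mono fun n hn => (valPNeg_pos hφ hn).le)
      (hd.mono fun n hn => (valPNeg_lt_lead hφ hn).le) hz

/-- One-sided convergence of `P⁻`-values to the endpoint `APNeg φ c k` of a cylinder, from the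
side of the cylinder. -/
theorem tendsto_valPNeg_APNeg_iff {φ : List ℕ → ℕ} (hφ : ∀ l, 0 < φ l) {c : ℕ → ℕ} {k : ℕ}
    (hc : PAdmissibleTuple φ c k) {d : ι → ℕ → ℕ} (hd : ∀ᶠ n in l, PAdmissibleSeq φ (d n))
    (hodd : Odd k → ∀ᶠ n in l, valPNeg φ (d n) < APNeg φ c k)
    (heven : Even k → ∀ᶠ n in l, APNeg φ c k < valPNeg φ (d n)) :
    Tendsto (fun n => valPNeg φ (d n)) l (𝓝 (APNeg φ c k)) ↔
      (∀ᶠ n in l, ∀ i < k, d n i = c i) ∧ Tendsto (fun n => d n k) l atTop := by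
  induction k generalizing φ c d with
  | zero => simpa [APNeg] using tendsto_valPNeg_zero_iff hφ hd
  | succ k ih =>
    have hφ' := shiftFamily_pos hφ (c 0)
    have hD := digit_coeff_pos (hφ []) hc.first
    have hsub := digit_lead_sub_coeff (hφ []) hc.first
    obtain ⟨hA0, hA1⟩ := APNeg_mem_Icc hφ' hc.tail
    have hmem : Tendsto (fun n => valPNeg φ (d n)) l (𝓝 (APNeg φ c (k + 1))) →
        ∀ᶠ n in l, d n 0 = c 0 := by
      intro h
      have hIoo : ∀ᶠ n in l, valPNeg φ (d n) ∈
          Set.Ioo (φ [] / (c 0 : ℝ)) (φ [] / ((c 0 : ℝ) - 1)) := by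
        rcases Nat.even_or_odd k with hk | hk
        · have hlt := APNeg_lt_one_of_even hφ' hc.tail hk
          have hlow : φ [] / (c 0 : ℝ) < APNeg φ c (k + 1) := by
            rw [APNeg_succ, ← hsub]
            nlinarith
          have hup : APNeg φ c (k + 1) ≤ φ [] / ((c 0 : ℝ) - 1) := by
            rw [APNeg_succ]
            nlinarith
          filter_upwards [h.eventually_const_lt hlow, hodd hk.add_one] with n h1 h2
          exact ⟨h1, h2.trans_le hup⟩
        · have hpos := APNeg_pos_of_odd hφ' hc.tail hk
          have hlow : φ [] / (c 0 : ℝ) ≤ APNeg φ c (k + 1) := by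
            rw [APNeg_succ, ← hsub]
            nlinarith
          have hup : APNeg φ c (k + 1) < φ [] / ((c 0 : ℝ) - 1) := by
            rw [APNeg_succ]
            nlinarith
          filter_upwards [h.eventually_lt_const hup, heven hk.add_one] with n h1 h2
          exact ⟨hlow.trans_lt h2, h1⟩
      filter_upwards [hd, hIoo] with n hn h1
      exact first_eq_of_valPNeg_mem_Ioo hφ hn hc.first h1
    have key : (∀ᶠ n in l, d n 0 = c 0) →
        (Tendsto (fun n => valPNeg φ (d n)) l (𝓝 (APNeg φ c (k + 1))) ↔
          (∀ᶠ n in l, ∀ i < k + 1, d n i = c i) ∧ Tendsto (fun n => d n (k + 1)) l atTop) := by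
      intro h0
      have hval : ∀ᶠ n in l, valPNeg φ (d n) = φ [] / ((c 0 : ℝ) - 1) -
          φ [] / (((c 0 : ℝ) - 1) * c 0) *
            valPNeg (shiftFamily φ (c 0)) (seqTail (d n)) := by
        filter_upwards [hd, h0] with n hn h
        rw [valPNeg_eq_sub hφ hn, h]
      have hd' : ∀ᶠ n in l, PAdmissibleSeq (shiftFamily φ (c 0)) (seqTail (d n)) := by
        filter_upwards [hd, h0] with n hn h
        exact h ▸ hn.tail
      have ih' := ih hφ' hc.tail hd'
        (fun hk => by
          filter_upwards [hval, heven hk.add_one] with n h1 h2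
          rw [h1, APNeg_succ] at h2
          exact lt_of_mul_lt_mul_left (by linarith) hD.le)
        (fun hk => by
          filter_upwards [hval, hodd hk.add_one] with n h1 h2
          rw [h1, APNeg_succ] at h2
          exact lt_of_mul_lt_mul_left (by linarith) hD.le)
      have hprefix : (∀ᶠ n in l, ∀ i < k, seqTail (d n) i = seqTail c i) ↔
          ∀ᶠ n in l, ∀ i < k + 1, d n i = c i := by
        refine eventually_congr (h0.mono fun n h => ?_)
        rw [Nat.forall_lt_succ_left]
        exact ⟨fun H => ⟨h, H⟩, fun H => H.2⟩
      rw [← hprefix, tendsto_congr' hval, APNeg_succ]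
      refine Iff.trans ⟨fun h => ?_, fun h => (h.const_mul _).const_sub _⟩ ih'
      have h2 := (h.const_sub (φ [] / ((c 0 : ℝ) - 1))).const_mul
        (φ [] / (((c 0 : ℝ) - 1) * c 0))⁻¹
      simpa only [sub_sub_cancel, inv_mul_cancel_left₀ hD.ne'] using h2
    exact ⟨fun h => (key (hmem h)).1 h,
      fun h => (key (h.1.mono fun n hn => hn 0 k.succ_pos)).2 h⟩

end Tendsto

/-- convergence from the left to `x₀ = Sup^{P⁻}(c₁…c_k)`, `k` odd. -/
theorem stmt7 (φ : List ℕ → ℕ) (hφ : ∀ l, 0 < φ l)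
    (k : ℕ) (hk : Odd k)
    (c : ℕ → ℕ) (hc : PAdmissibleTuple φ c k)
    (d : ℕ → (ℕ → ℕ)) (hd : ∀ n, PAdmissibleSeq φ (d n))
    (hx : ∀ n, 0 < valPNeg φ (d n) ∧ valPNeg φ (d n) < SupPNeg φ c k) :
    Filter.Tendsto (fun n => valPNeg φ (d n)) Filter.atTop (nhds (SupPNeg φ c k)) ↔
      ∃ n0 : ℕ, (∀ n ≥ n0, ∀ i < k, d n i = c i) ∧
        Filter.Tendsto (fun n => d n k) Filter.atTop Filter.atTop := by
  rw [SupPNeg, if_pos hk] at hx ⊢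
  rw [tendsto_valPNeg_APNeg_iff hφ hc (Eventually.of_forall hd)
    (fun _ => Eventually.of_forall fun n => (hx n).2)
    (fun h => absurd hk (Nat.not_odd_iff_even.2 h)), eventually_atTop, exists_and_right]
end
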